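/- If A, B, C, D : Fin 2 → Matrix (Fin 2) (Fin 2) ℂ satisfy trace(A i * B j * C k * D l) = δ_{i,k} · δ_{j,l} for all i, j, k, l ∈ Fin 2, then each of the four families of products {A i * B j : i, j ∈ Fin 2}, {B j * C k : j, k ∈ Fin 2}, {C k * D l : k, l ∈ Fin 2} and {D l * A i : l, i ∈ Fin 2} is linearly independent in the space of 2×2 complex matrices (hence each is a basis of Matrix (Fin 2) (Fin 2) ℂ). -/

import Mathlib

open Matrix

theorem linearIndependent_of_trace_mul_eq_ite {ι n R : Type*} [Fintype ι] [DecidableEq ι]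
    [Fintype n] [CommRing R] (X Y : ι → Matrix n n R)
    (h : ∀ p q, (X p * Y q).trace = if p = q then 1 else 0) :
    LinearIndependent R X := by
  rw [Fintype.linearIndependent_iff]
  intro g hg q
  have hq := congrArg (fun M => (M * Y q).trace) hg
  simpa [Finset.sum_mul, trace_sum, h] using hq

/-- In any square-network solution of dimension 2, each family of products of
consecutive matrices is linearly independent (hence a basis of the 4-dimensional
space of 2×2 complex matrices). -/
theorem square_network_solution_products_linearIndependent
    (A B C D : Fin 2 → Matrix (Fin 2) (Fin 2) ℂ)
    (h : ∀ i j k l : Fin 2,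
      (A i * B j * C k * D l).trace =
        (if i = k then 1 else 0) * (if j = l then 1 else 0)) :
    LinearIndependent ℂ (fun p : Fin 2 × Fin 2 => A p.1 * B p.2) ∧
    LinearIndependent ℂ (fun p : Fin 2 × Fin 2 => B p.1 * C p.2) ∧
    LinearIndependent ℂ (fun p : Fin 2 × Fin 2 => C p.1 * D p.2) ∧
    LinearIndependent ℂ (fun p : Fin 2 × Fin 2 => D p.1 * A p.2) := by
  have hCDAB (i j k l : Fin 2) : (C k * D l * (A i * B j)).trace =
      (if i = k then 1 else 0) * (if j = l then 1 else 0) := by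
    rw [trace_mul_comm, ← h, Matrix.mul_assoc (A i * B j)]
  have hDABC (i j k l : Fin 2) : (D l * A i * (B j * C k)).trace =
      (if i = k then 1 else 0) * (if j = l then 1 else 0) := by
    rw [← h, trace_mul_comm _ (D l)]
    simp only [Matrix.mul_assoc]
  refine ⟨linearIndependent_of_trace_mul_eq_ite _ (fun q => C q.1 * D q.2) ?_,
    linearIndependent_of_trace_mul_eq_ite _ (fun q => D q.1 * A q.2) ?_,
    linearIndependent_of_trace_mul_eq_ite _ (fun q => A q.1 * B q.2) ?_,
    linearIndependent_of_trace_mul_eq_ite _ (fun q => B q.1 * C q.2) ?_⟩ <;>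
    rintro ⟨a, b⟩ ⟨c, d⟩
  · rw [← Matrix.mul_assoc, h]
    grind
  · rw [trace_mul_comm, hDABC]
    grind
  · rw [hCDAB]
    grind
  · rw [hDABC]
    grind
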